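/- arXiv:1704.03555 — 6 statements merged into one kernel-verified Lean document; each statement's English description precedes it below -/
import Mathlib

section
/- Let 𝒟 ⊆ ℝⁿ be nonempty. Then the robust reach-avoid sets satisfy the recursion: RA_0(𝒯, 𝒦, 𝒟) = 𝒯, and for every integer k ≥ 1, RA_k(𝒯, 𝒦, 𝒟) = { x₀ ∈ 𝒦 : F(x₀) ∩ (RA_{k−1}(𝒯, 𝒦, 𝒟) ⊖ 𝒟) ≠ ∅ }. -/
/-- Closed-loop trajectory of the perturbed system `x_{k+1} = f(x_k, ν_k(x_k)) + w_k`. -/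
def traj {n m : ℕ} (f : (Fin n → ℝ) → (Fin m → ℝ) → (Fin n → ℝ))
    (ν : ℕ → (Fin n → ℝ) → (Fin m → ℝ)) (w : ℕ → (Fin n → ℝ)) (x0 : Fin n → ℝ) :
    ℕ → (Fin n → ℝ)
  | 0 => x0
  | k + 1 => f (traj f ν w x0 k) (ν k (traj f ν w x0 k)) + w k

/-- The `t`-step robust reach-avoid set `RA_t(𝒯, 𝒦, 𝒟)`. -/
def RA {n m : ℕ} (f : (Fin n → ℝ) → (Fin m → ℝ) → (Fin n → ℝ)) (U : Set (Fin m → ℝ))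
    (T K D : Set (Fin n → ℝ)) (t : ℕ) : Set (Fin n → ℝ) :=
  {x0 | ∃ ν : ℕ → (Fin n → ℝ) → (Fin m → ℝ),
    (∀ k, k < t → ∀ x, ν k x ∈ U) ∧
    ∀ w : ℕ → (Fin n → ℝ), (∀ k, k < t → w k ∈ D) →
      (∀ k, k < t → traj f ν w x0 k ∈ K) ∧ traj f ν w x0 t ∈ T}

/-- The unperturbed one-step forward reach set `F(x) = { f(x,u) : u ∈ 𝒰 }`. -/
def fwdReach {n m : ℕ} (f : (Fin n → ℝ) → (Fin m → ℝ) → (Fin n → ℝ)) (U : Set (Fin m → ℝ))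
    (x : Fin n → ℝ) : Set (Fin n → ℝ) :=
  {y | ∃ u ∈ U, y = f x u}

/-- The Minkowski difference `S ⊖ D = { s : s + d ∈ S for all d ∈ D }`. -/
def minkDiff {n : ℕ} (S D : Set (Fin n → ℝ)) : Set (Fin n → ℝ) :=
  {s | ∀ d ∈ D, s + d ∈ S}

theorem traj_succ_eq_traj_tail {n m : ℕ} (f : (Fin n → ℝ) → (Fin m → ℝ) → (Fin n → ℝ))
    (ν : ℕ → (Fin n → ℝ) → (Fin m → ℝ)) (w : ℕ → (Fin n → ℝ)) (x0 : Fin n → ℝ) (k : ℕ) :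
    traj f ν w x0 (k + 1) =
      traj f (fun i => ν (i + 1)) (fun i => w (i + 1)) (f x0 (ν 0 x0) + w 0) k := by
  induction k with
  | zero => rfl
  | succ k ih => rw [traj, ih]; rfl

theorem exists_input_of_mem_RA_succ {n m : ℕ} {f : (Fin n → ℝ) → (Fin m → ℝ) → (Fin n → ℝ)}
    {U : Set (Fin m → ℝ)} {T K D : Set (Fin n → ℝ)} (hD : D.Nonempty) {t : ℕ} {x : Fin n → ℝ}
    (hx : x ∈ RA f U T K D (t + 1)) :
    x ∈ K ∧ ∃ u ∈ U, ∀ d ∈ D, f x u + d ∈ RA f U T K D t := by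
  obtain ⟨ν, hν, h⟩ := hx
  obtain ⟨d₀, hd₀⟩ := hD
  refine ⟨(h (fun _ => d₀) fun _ _ => hd₀).1 0 t.succ_pos, ν 0 x, hν 0 t.succ_pos x,
    fun d hd => ⟨fun i => ν (i + 1), fun k hk => hν (k + 1) (by lia), fun w hw => ?_⟩⟩
  have key := h (fun i => Nat.casesOn i d w) (fun k hk => by
    cases k with
    | zero => exact hd
    | succ k => exact hw k (by lia))
  refine ⟨fun k hk => ?_, ?_⟩
  · have := key.1 (k + 1) (by lia)
    rwa [traj_succ_eq_traj_tail] at this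
  · have := key.2
    rwa [traj_succ_eq_traj_tail] at this

/-- A single feedback policy achieves the reach-avoid objective from every point of `RA_t`. -/
theorem exists_uniform_policy {n m : ℕ} (f : (Fin n → ℝ) → (Fin m → ℝ) → (Fin n → ℝ))
    {U : Set (Fin m → ℝ)} (hU : U.Nonempty) (T K : Set (Fin n → ℝ)) {D : Set (Fin n → ℝ)}
    (hD : D.Nonempty) (t : ℕ) :
    ∃ ν : ℕ → (Fin n → ℝ) → (Fin m → ℝ), (∀ k x, ν k x ∈ U) ∧
      ∀ x0 ∈ RA f U T K D t, ∀ w : ℕ → (Fin n → ℝ), (∀ k, k < t → w k ∈ D) →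
        (∀ k, k < t → traj f ν w x0 k ∈ K) ∧ traj f ν w x0 t ∈ T := by
  obtain ⟨u₀, hu₀⟩ := hU
  induction t with
  | zero =>
    refine ⟨fun _ _ => u₀, fun _ _ => hu₀, fun x0 hx w hw => ⟨by simp, ?_⟩⟩
    obtain ⟨ν, -, h⟩ := hx
    exact (h w hw).2
  | succ t ih =>
    obtain ⟨ν, hν, h⟩ := ih
    have hinput : ∀ x, ∃ u ∈ U, x ∈ RA f U T K D (t + 1) →
        ∀ d ∈ D, f x u + d ∈ RA f U T K D t := fun x => by
      by_cases hx : x ∈ RA f U T K D (t + 1)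
      · obtain ⟨-, u, hu, hnext⟩ := exists_input_of_mem_RA_succ hD hx
        exact ⟨u, hu, fun _ => hnext⟩
      · exact ⟨u₀, hu₀, fun hx' => absurd hx' hx⟩
    choose g hgU hg using hinput
    refine ⟨fun i => Nat.casesOn i g ν, fun k => ?_, fun x hx w hw => ?_⟩
    · cases k with
      | zero => exact hgU
      | succ k => exact hν k
    have key := h _ (hg x hx (w 0) (hw 0 t.succ_pos)) (fun i => w (i + 1))
      fun k hk => hw (k + 1) (by lia)
    refine ⟨fun k hk => ?_, ?_⟩
    · cases k with
      | zero => exact (exists_input_of_mem_RA_succ hD hx).1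
      | succ k =>
        rw [traj_succ_eq_traj_tail]
        exact key.1 k (by lia)
    · rw [traj_succ_eq_traj_tail]
      exact key.2

theorem mem_RA_succ_of_input {n m : ℕ} {f : (Fin n → ℝ) → (Fin m → ℝ) → (Fin n → ℝ)}
    {U : Set (Fin m → ℝ)} {T K D : Set (Fin n → ℝ)} (hD : D.Nonempty) {t : ℕ} {x : Fin n → ℝ}
    (hx : x ∈ K) {u : Fin m → ℝ} (hu : u ∈ U) (hnext : ∀ d ∈ D, f x u + d ∈ RA f U T K D t) :
    x ∈ RA f U T K D (t + 1) := by
  obtain ⟨ν, hν, h⟩ := exists_uniform_policy f ⟨u, hu⟩ T K hD t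
  refine ⟨fun i => Nat.casesOn i (fun _ => u) ν, fun k _ => ?_, fun w hw => ?_⟩
  · cases k with
    | zero => exact fun _ => hu
    | succ k => exact hν k
  have key := h _ (hnext (w 0) (hw 0 t.succ_pos)) (fun i => w (i + 1))
    fun k hk => hw (k + 1) (by lia)
  refine ⟨fun k hk => ?_, ?_⟩
  · cases k with
    | zero => exact hx
    | succ k =>
      rw [traj_succ_eq_traj_tail]
      exact key.1 k (by lia)
  · rw [traj_succ_eq_traj_tail]
    exact key.2

/-- the robust reach-avoid sets satisfy the recursion
`RA_0 = 𝒯` and `RA_k = { x₀ ∈ 𝒦 : F(x₀) ∩ (RA_{k-1} ⊖ 𝒟) ≠ ∅ }` for `k ≥ 1`. -/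
theorem robust_reach_avoid_recursion {n m : ℕ}
    (f : (Fin n → ℝ) → (Fin m → ℝ) → (Fin n → ℝ)) (U : Set (Fin m → ℝ))
    (T K D : Set (Fin n → ℝ)) (hD : D.Nonempty) :
    RA f U T K D 0 = T ∧
      ∀ k : ℕ, 1 ≤ k →
        RA f U T K D k =
          {x0 ∈ K | (fwdReach f U x0 ∩ minkDiff (RA f U T K D (k - 1)) D).Nonempty} := by
  refine ⟨?_, fun k hk => ?_⟩
  · ext x
    simp only [RA, Set.mem_ofPred_eq, Nat.not_lt_zero, false_imp_iff, implies_true, true_and,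
      traj]
    exact ⟨fun ⟨_, h⟩ => h 0 trivial, fun h => ⟨0, fun _ _ => h⟩⟩
  · obtain ⟨t, rfl⟩ := Nat.exists_eq_add_of_le' hk
    ext x
    constructor
    · intro hx
      obtain ⟨hxK, u, hu, hnext⟩ := exists_input_of_mem_RA_succ hD hx
      exact ⟨hxK, f x u, ⟨u, hu, rfl⟩, hnext⟩
    · rintro ⟨hxK, _, ⟨u, hu, rfl⟩, hnext⟩
      exact mem_RA_succ_of_input hD hxK hu hnext
end

section
/- Let 𝒟 ⊆ ℝⁿ be nonempty. Then the robust reach-avoid sets satisfy: RA_0(𝒯, 𝒦, 𝒟) = 𝒯, and for every integer k ≥ 1, RA_k(𝒯, 𝒦, 𝒟) = 𝒦 ∩ R⁻( RA_{k−1}(𝒯, 𝒦, 𝒟) ⊖ 𝒟 ). -/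
/-- The one-step backward reach set `R⁻(S) = { x : F(x) ∩ S ≠ ∅ }`. -/
def backReach {n m : ℕ} (f : (Fin n → ℝ) → (Fin m → ℝ) → (Fin n → ℝ)) (U : Set (Fin m → ℝ))
    (S : Set (Fin n → ℝ)) : Set (Fin n → ℝ) :=
  {x | (fwdReach f U x ∩ S).Nonempty}

theorem traj_succ_eq_shift {n m : ℕ} (f : (Fin n → ℝ) → (Fin m → ℝ) → (Fin n → ℝ))
    (ν : ℕ → (Fin n → ℝ) → (Fin m → ℝ)) (w : ℕ → (Fin n → ℝ)) (x : Fin n → ℝ) (k : ℕ) :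
    traj f ν w x (k + 1) =
      traj f (fun j => ν (j + 1)) (fun j => w (j + 1)) (f x (ν 0 x) + w 0) k := by
  induction k with
  | zero => rfl
  | succ k ih => rw [traj, ih, traj]

theorem RA_succ_subset {n m : ℕ} (f : (Fin n → ℝ) → (Fin m → ℝ) → (Fin n → ℝ))
    (U : Set (Fin m → ℝ)) (T K D : Set (Fin n → ℝ)) (hD : D.Nonempty) (t : ℕ) :
    RA f U T K D (t + 1) ⊆ K ∩ backReach f U (minkDiff (RA f U T K D t) D) := by
  rintro x ⟨ν, hν, h⟩
  obtain ⟨d₀, hd₀⟩ := hD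
  refine ⟨(h (fun _ => d₀) fun _ _ => hd₀).1 0 t.succ_pos, f x (ν 0 x),
    ⟨ν 0 x, hν 0 t.succ_pos x, rfl⟩, fun d hd => ?_⟩
  refine ⟨fun j => ν (j + 1), fun k hk => hν (k + 1) (Nat.succ_lt_succ hk), fun w hw => ?_⟩
  obtain ⟨hK, hT⟩ := h (fun j => Nat.casesOn j d w) (by
    rintro (_ | k) hk
    · exact hd
    · exact hw k (Nat.lt_of_succ_lt_succ hk))
  rw [traj_succ_eq_shift] at hT
  refine ⟨fun k hk => ?_, hT⟩
  have := hK (k + 1) (Nat.succ_lt_succ hk)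
  rwa [traj_succ_eq_shift] at this

/-- A single policy witnesses membership in the robust reach-avoid set for every point of `S`. -/
def IsUniformPolicy {n m : ℕ} (f : (Fin n → ℝ) → (Fin m → ℝ) → (Fin n → ℝ))
    (U : Set (Fin m → ℝ)) (T K D : Set (Fin n → ℝ)) (t : ℕ) (S : Set (Fin n → ℝ))
    (ν : ℕ → (Fin n → ℝ) → (Fin m → ℝ)) : Prop :=
  (U.Nonempty → ∀ k x, ν k x ∈ U) ∧
    ∀ x ∈ S, ∀ w : ℕ → (Fin n → ℝ), (∀ k, k < t → w k ∈ D) →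
      (∀ k, k < t → traj f ν w x k ∈ K) ∧ traj f ν w x t ∈ T

theorem IsUniformPolicy.exists_succ {n m : ℕ} {f : (Fin n → ℝ) → (Fin m → ℝ) → (Fin n → ℝ)}
    {U : Set (Fin m → ℝ)} {T K D : Set (Fin n → ℝ)} {t : ℕ} {S : Set (Fin n → ℝ)}
    {ν : ℕ → (Fin n → ℝ) → (Fin m → ℝ)} (h : IsUniformPolicy f U T K D t S ν) :
    ∃ μ, IsUniformPolicy f U T K D (t + 1) (K ∩ backReach f U (minkDiff S D)) μ := by
  have hex : ∀ x, ∃ u, (U.Nonempty → u ∈ U) ∧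
      (x ∈ backReach f U (minkDiff S D) → f x u ∈ minkDiff S D) := by
    intro x
    by_cases hx : x ∈ backReach f U (minkDiff S D)
    · obtain ⟨_, ⟨u, hu, rfl⟩, hy⟩ := hx
      exact ⟨u, fun _ => hu, fun _ => hy⟩
    · exact ⟨ν 0 x, fun hU => h.1 hU 0 x, fun hx' => absurd hx' hx⟩
  choose g hgU hg using hex
  refine ⟨fun j => Nat.casesOn j g ν, ?_, ?_⟩
  · rintro hU (_ | k) x
    · exact hgU x hU
    · exact h.1 hU k x
  · rintro x ⟨hxK, hx⟩ w hw
    obtain ⟨hK, hT⟩ := h.2 _ (hg x hx (w 0) (hw 0 t.succ_pos)) (fun j => w (j + 1))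
      fun k hk => hw (k + 1) (Nat.succ_lt_succ hk)
    refine ⟨?_, by rwa [traj_succ_eq_shift]⟩
    rintro (_ | k) hk
    · exact hxK
    · rw [traj_succ_eq_shift]
      exact hK k (Nat.lt_of_succ_lt_succ hk)

theorem RA_zero {n m : ℕ} (f : (Fin n → ℝ) → (Fin m → ℝ) → (Fin n → ℝ))
    (U : Set (Fin m → ℝ)) (T K D : Set (Fin n → ℝ)) : RA f U T K D 0 = T := by
  ext x
  constructor
  · rintro ⟨ν, -, h⟩
    exact (h 0 fun k hk => absurd hk k.not_lt_zero).2
  · exact fun hx => ⟨0, fun k hk => absurd hk k.not_lt_zero,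
      fun _ _ => ⟨fun k hk => absurd hk k.not_lt_zero, hx⟩⟩

theorem exists_isUniformPolicy_RA {n m : ℕ} (f : (Fin n → ℝ) → (Fin m → ℝ) → (Fin n → ℝ))
    (U : Set (Fin m → ℝ)) (T K D : Set (Fin n → ℝ)) (hD : D.Nonempty) (t : ℕ) :
    ∃ ν, IsUniformPolicy f U T K D t (RA f U T K D t) ν := by
  induction t with
  | zero =>
    obtain ⟨u, hu⟩ : ∃ u, U.Nonempty → u ∈ U := by
      by_cases hU : U.Nonempty
      · exact ⟨hU.some, fun _ => hU.some_mem⟩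
      · exact ⟨0, fun h => absurd h hU⟩
    rw [RA_zero]
    exact ⟨fun _ _ => u, fun hU _ _ => hu hU,
      fun x hx _ _ => ⟨fun k hk => absurd hk k.not_lt_zero, hx⟩⟩
  | succ t ih =>
    obtain ⟨ν, hν⟩ := ih
    obtain ⟨μ, hμU, hμ⟩ := hν.exists_succ
    exact ⟨μ, hμU, fun x hx => hμ x (RA_succ_subset f U T K D hD t hx)⟩

/-- `RA_0 = 𝒯` and `RA_k = 𝒦 ∩ R⁻(RA_{k-1} ⊖ 𝒟)` for `k ≥ 1`. -/
theorem robust_reach_avoid_backreach_recursion {n m : ℕ}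
    (f : (Fin n → ℝ) → (Fin m → ℝ) → (Fin n → ℝ)) (U : Set (Fin m → ℝ))
    (T K D : Set (Fin n → ℝ)) (hD : D.Nonempty) :
    RA f U T K D 0 = T ∧
      ∀ k : ℕ, 1 ≤ k →
        RA f U T K D k = K ∩ backReach f U (minkDiff (RA f U T K D (k - 1)) D) := by
  refine ⟨RA_zero f U T K D, ?_⟩
  rintro (_ | t) ht
  · exact absurd ht (Nat.not_succ_le_zero 0)
  · refine (RA_succ_subset f U T K D hD t).antisymm fun x hx => ?_
    obtain ⟨ν, hν⟩ := exists_isUniformPolicy_RA f U T K D hD t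
    obtain ⟨μ, hμU, hμ⟩ := hν.exists_succ
    have hU : U.Nonempty := by
      obtain ⟨-, _, ⟨u, hu, -⟩, -⟩ := hx
      exact ⟨u, hu⟩
    exact ⟨μ, fun k _ => hμU hU k, hμ x hx⟩
end

section
/- Let 𝒰 ⊆ ℝ^m and 𝒟 ⊆ ℝⁿ be nonempty and fix an integer t ≥ 1. Then the zero sublevel set of the minmax dynamic-programming value function equals the robust reach-avoid set: { x ∈ ℝⁿ : J_0(x) = 0 } = RA_t(𝒯, 𝒦, 𝒟). -/
/-- Minmax dynamic-programming value functions, indexed by the number of remaining steps: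
`Jstep 0 = g_t = 1 - 1_𝒯` and
`Jstep (j+1) x = inf_{u ∈ 𝒰} sup_{w ∈ 𝒟} [ Jstep j (f(x,u) + w) + (1 - 1_𝒦(x)) ]`.
The value function `J_k` of the horizon-`t` problem is `Jstep (t - k)`. -/
noncomputable def Jstep {n m : ℕ} (f : (Fin n → ℝ) → (Fin m → ℝ) → (Fin n → ℝ))
    (U : Set (Fin m → ℝ)) (D K T : Set (Fin n → ℝ)) : ℕ → (Fin n → ℝ) → ℝ
  | 0 => fun x => 1 - T.indicator (fun _ => (1 : ℝ)) x
  | j + 1 => fun x =>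
      sInf ((fun u => sSup ((fun w =>
        Jstep f U D K T j (f x u + w) + (1 - K.indicator (fun _ => (1 : ℝ)) x)) '' D)) '' U)

/-- The infimum of a nonempty bounded set of natural numbers, taken in `ℝ`, is attained, and so is
its supremum. -/
lemma csInf_mem_and_csSup_mem_of_natCast_le {S : Set ℝ} (hS : S.Nonempty) {N : ℕ}
    (h : ∀ a ∈ S, ∃ p : ℕ, p ≤ N ∧ a = p) : sInf S ∈ S ∧ sSup S ∈ S := by
  have hfin : S.Finite :=
    ((Set.finite_Iic N).image ((↑) : ℕ → ℝ)).subset fun a ha => by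
      obtain ⟨p, hp, rfl⟩ := h a ha
      exact ⟨p, hp, rfl⟩
  exact ⟨hS.csInf_mem hfin, hS.csSup_mem hfin⟩

/-- If a payoff takes natural values at most `N`, then so does its minmax value, and the minmax
value is zero exactly when some minimizing choice makes the payoff vanish identically. -/
lemma minmax_natCast_le_and_eq_zero_iff {α β : Type*} {U : Set α} {D : Set β} (hU : U.Nonempty)
    (hD : D.Nonempty) (g : α → β → ℝ) {N : ℕ} (hg : ∀ u w, ∃ p : ℕ, p ≤ N ∧ g u w = p) :
    (∃ p : ℕ, p ≤ N ∧ sInf ((fun u => sSup ((fun w => g u w) '' D)) '' U) = p) ∧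
      (sInf ((fun u => sSup ((fun w => g u w) '' D)) '' U) = 0 ↔
        ∃ u ∈ U, ∀ w ∈ D, g u w = 0) := by
  have hnonneg : ∀ u w, 0 ≤ g u w := fun u w => by
    obtain ⟨p, -, hp⟩ := hg u w
    exact hp ▸ p.cast_nonneg
  have hstage : ∀ u, ∀ a ∈ (fun w => g u w) '' D, ∃ p : ℕ, p ≤ N ∧ a = p := by
    rintro u _ ⟨w, -, rfl⟩
    exact hg u w
  have hsup_mem : ∀ u, sSup ((fun w => g u w) '' D) ∈ (fun w => g u w) '' D := fun u =>
    (csInf_mem_and_csSup_mem_of_natCast_le (hD.image _) (hstage u)).2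
  have hle_sup : ∀ u, ∀ w ∈ D, g u w ≤ sSup ((fun w => g u w) '' D) := fun u w hw => by
    refine le_csSup ⟨N, fun a ha => ?_⟩ (Set.mem_image_of_mem _ hw)
    obtain ⟨p, hp, rfl⟩ := hstage u a ha
    exact_mod_cast hp
  have hsup_nonneg : ∀ u, 0 ≤ sSup ((fun w => g u w) '' D) := fun u => by
    obtain ⟨w, -, hw⟩ := hsup_mem u
    exact (hnonneg u w).trans_eq hw
  have hsup : ∀ a ∈ (fun u => sSup ((fun w => g u w) '' D)) '' U, ∃ p : ℕ, p ≤ N ∧ a = p := by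
    rintro _ ⟨u, -, rfl⟩
    exact hstage u _ (hsup_mem u)
  have hinf_mem := (csInf_mem_and_csSup_mem_of_natCast_le (hU.image _) hsup).1
  refine ⟨hsup _ hinf_mem, fun h0 => ?_, ?_⟩
  · obtain ⟨u, hu, he⟩ := hinf_mem
    exact ⟨u, hu, fun w hw =>
      le_antisymm ((hle_sup u w hw).trans (he.trans h0).le) (hnonneg u w)⟩
  · rintro ⟨u, hu, h⟩
    have hsup_zero : sSup ((fun w => g u w) '' D) = 0 := by
      obtain ⟨w, hw, he⟩ := hsup_mem u
      exact he.symm.trans (h w hw)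
    have hlower : ∀ a ∈ (fun u => sSup ((fun w => g u w) '' D)) '' U, 0 ≤ a := by
      rintro _ ⟨v, -, rfl⟩
      exact hsup_nonneg v
    exact IsLeast.csInf_eq ⟨⟨u, hu, hsup_zero⟩, hlower⟩

section

variable {n m : ℕ} (f : (Fin n → ℝ) → (Fin m → ℝ) → (Fin n → ℝ)) {U : Set (Fin m → ℝ)}
  (T K : Set (Fin n → ℝ)) {D : Set (Fin n → ℝ)}

lemma Jstep_add_stageCost_natCast_le {j : ℕ}
    (hJ : ∀ x, ∃ p : ℕ, p ≤ j + 1 ∧ Jstep f U D K T j x = p) (x y : Fin n → ℝ) :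
    ∃ p : ℕ, p ≤ j + 1 + 1 ∧
      Jstep f U D K T j y + (1 - K.indicator (fun _ => (1 : ℝ)) x) = p := by
  obtain ⟨p, hp, he⟩ := hJ y
  by_cases hx : x ∈ K
  · exact ⟨p, by omega, by simp [he, hx]⟩
  · exact ⟨p + 1, by omega, by simp [he, hx]⟩

lemma Jstep_natCast_le (hU : U.Nonempty) (hD : D.Nonempty) (j : ℕ) :
    ∀ x, ∃ p : ℕ, p ≤ j + 1 ∧ Jstep f U D K T j x = p := by
  induction j with
  | zero =>
    intro x
    by_cases hx : x ∈ T
    · exact ⟨0, by simp, by simp [Jstep, hx]⟩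
    · exact ⟨1, by simp, by simp [Jstep, hx]⟩
  | succ j ih =>
    intro x
    exact (minmax_natCast_le_and_eq_zero_iff hU hD _ fun u w =>
      Jstep_add_stageCost_natCast_le f T K ih x (f x u + w)).1

lemma Jstep_zero_eq_zero_iff (x : Fin n → ℝ) : Jstep f U D K T 0 x = 0 ↔ x ∈ T := by
  by_cases hx : x ∈ T <;> simp [Jstep, hx]

lemma Jstep_succ_eq_zero_iff (hU : U.Nonempty) (hD : D.Nonempty) (j : ℕ) (x : Fin n → ℝ) :
    Jstep f U D K T (j + 1) x = 0 ↔
      x ∈ K ∧ ∃ u ∈ U, ∀ w ∈ D, Jstep f U D K T j (f x u + w) = 0 := by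
  have hJ := Jstep_natCast_le f T K hU hD j
  refine (minmax_natCast_le_and_eq_zero_iff hU hD _ fun u w =>
    Jstep_add_stageCost_natCast_le f T K hJ x (f x u + w)).2.trans ?_
  by_cases hx : x ∈ K
  · simp [hx]
  · simp only [hx, false_and, iff_false]
    rintro ⟨u, -, h⟩
    obtain ⟨w, hw⟩ := hD
    obtain ⟨p, -, hp⟩ := hJ (f x u + w)
    have hzero := h w hw
    rw [hp, Set.indicator_of_notMem hx] at hzero
    linarith [p.cast_nonneg (α := ℝ)]

lemma traj_succ_eq_traj_shift (ν : ℕ → (Fin n → ℝ) → (Fin m → ℝ)) (w : ℕ → (Fin n → ℝ))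
    (x : Fin n → ℝ) (k : ℕ) :
    traj f ν w x (k + 1) =
      traj f (fun i => ν (i + 1)) (fun i => w (i + 1)) (f x (ν 0 x) + w 0) k := by
  induction k with
  | zero => rfl
  | succ k ih => rw [traj, ih, traj]

lemma Jstep_eq_zero_of_mem_RA (hU : U.Nonempty) (hD : D.Nonempty) (t : ℕ) :
    ∀ x ∈ RA f U T K D t, Jstep f U D K T t x = 0 := by
  induction t with
  | zero =>
    rintro x ⟨ν, -, h⟩
    exact (Jstep_zero_eq_zero_iff f T K x).2 (h 0 (by simp)).2
  | succ t ih =>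
    rintro x ⟨ν, hν, h⟩
    obtain ⟨d, hd⟩ := hD
    refine (Jstep_succ_eq_zero_iff f T K hU ⟨d, hd⟩ t x).2
      ⟨(h (fun _ => d) fun _ _ => hd).1 0 t.succ_pos, ν 0 x, hν 0 t.succ_pos x, fun w₀ hw₀ => ?_⟩
    refine ih _ ⟨fun k => ν (k + 1), fun k hk => hν (k + 1) (by omega), fun w hw => ?_⟩
    obtain ⟨hK, hT⟩ := h (fun | 0 => w₀ | k + 1 => w k) fun
      | 0, _ => hw₀
      | k + 1, hk => hw k (by omega)
    rw [traj_succ_eq_traj_shift] at hT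
    refine ⟨fun k hk => ?_, hT⟩
    have hk' := hK (k + 1) (by omega)
    rwa [traj_succ_eq_traj_shift] at hk'

lemma mem_RA_of_Jstep_eq_zero (hU : U.Nonempty) (hD : D.Nonempty) (t : ℕ) (x : Fin n → ℝ)
    (hx : Jstep f U D K T t x = 0) : x ∈ RA f U T K D t := by
  have hselect : ∀ j y, ∃ u ∈ U, Jstep f U D K T (j + 1) y = 0 →
      ∀ w ∈ D, Jstep f U D K T j (f y u + w) = 0 := fun j y => by
    by_cases hy : Jstep f U D K T (j + 1) y = 0
    · obtain ⟨-, u, hu, h⟩ := (Jstep_succ_eq_zero_iff f T K hU hD j y).1 hy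
      exact ⟨u, hu, fun _ => h⟩
    · exact ⟨hU.some, hU.some_mem, fun h => absurd h hy⟩
  choose κ hκU hκ using hselect
  refine ⟨fun k => κ (t - 1 - k), fun k _ y => hκU _ y, fun w hw => ?_⟩
  have hinv : ∀ k ≤ t, Jstep f U D K T (t - k) (traj f (fun k => κ (t - 1 - k)) w x k) = 0 := by
    intro k
    induction k with
    | zero => exact fun _ => hx
    | succ k ih =>
      intro hk
      have hprev := ih (by omega)
      rw [show t - k = t - 1 - k + 1 by omega] at hprev
      rw [show t - (k + 1) = t - 1 - k by omega]
      exact hκ _ _ hprev _ (hw k hk)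
  refine ⟨fun k hk => ?_, ?_⟩
  · have hk' := hinv k hk.le
    rw [show t - k = t - 1 - k + 1 by omega] at hk'
    exact ((Jstep_succ_eq_zero_iff f T K hU hD _ _).1 hk').1
  · have ht := hinv t le_rfl
    rw [Nat.sub_self] at ht
    exact (Jstep_zero_eq_zero_iff f T K _).1 ht

end

/-- the zero sublevel set of the minmax value function `J_0 = Jstep t`
equals the `t`-step robust reach-avoid set. -/
theorem minmax_zero_level_eq_robust_reach_avoid {n m : ℕ}
    (f : (Fin n → ℝ) → (Fin m → ℝ) → (Fin n → ℝ)) (U : Set (Fin m → ℝ))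
    (T K D : Set (Fin n → ℝ)) (hU : U.Nonempty) (hD : D.Nonempty)
    (t : ℕ) (ht : 1 ≤ t) :
    {x : Fin n → ℝ | Jstep f U D K T t x = 0} = RA f U T K D t := by
  exact Set.Subset.antisymm (fun x hx => mem_RA_of_Jstep_eq_zero f T K hU hD t x hx)
    (Jstep_eq_zero_of_mem_RA f T K hU hD t)
end

section
/- Suppose 𝒦 ⊆ ℝⁿ and 𝒯 ⊆ ℝⁿ are closed, 𝒰 ⊆ ℝ^m is nonempty and compact, 𝒟 ⊆ ℝⁿ is nonempty, and f : ℝⁿ × ℝ^m → ℝⁿ is continuous. Then for every k ∈ {0, …, t−1} there exists a Borel-measurable state-feedback law ν_k : ℝⁿ → 𝒰 attaining the infimum in the minmax recursion, i.e., for every x ∈ ℝⁿ, sup_{w ∈ 𝒟} [ J_{k+1}( f(x, ν_k(x)) + w ) + g_k(x) ] = J_k(x). -/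
open Set

section Selection

variable {X Y : Type*} [TopologicalSpace X] [TopologicalSpace Y] {φ : X × Y → ℝ} {C : Set Y}

theorem LowerSemicontinuous.exists_eq_sInf_image (hφ : LowerSemicontinuous φ)
    (hC : IsCompact C) (hne : C.Nonempty) (x : X) :
    ∃ y ∈ C, φ (x, y) = sInf ((fun y => φ (x, y)) '' C) ∧ ∀ z ∈ C, φ (x, y) ≤ φ (x, z) := by
  obtain ⟨y, hy, hmin⟩ := LowerSemicontinuousOn.exists_isMinOn hne hC
    ((hφ.comp (Continuous.prodMk_right x)).lowerSemicontinuousOn C)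
  have hle : ∀ z ∈ C, φ (x, y) ≤ φ (x, z) := fun z hz => hmin hz
  refine ⟨y, hy, ?_, hle⟩
  refine (IsLeast.csInf_eq (s := (fun y => φ (x, y)) '' C) ⟨⟨y, hy, rfl⟩, ?_⟩).symm
  rintro _ ⟨z, hz, rfl⟩
  exact hle z hz

theorem LowerSemicontinuous.sInf_image_le_iff (hφ : LowerSemicontinuous φ)
    (hC : IsCompact C) (hne : C.Nonempty) (x : X) (c : ℝ) :
    sInf ((fun y => φ (x, y)) '' C) ≤ c ↔ ∃ y ∈ C, φ (x, y) ≤ c := by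
  obtain ⟨y, hy, heq, hle⟩ := hφ.exists_eq_sInf_image hC hne x
  rw [← heq]
  exact ⟨fun h => ⟨y, hy, h⟩, fun ⟨z, hz, h⟩ => (hle z hz).trans h⟩

/-- Minimising a jointly lower semicontinuous function over a compact set preserves lower
semicontinuity in the parameter. -/
theorem LowerSemicontinuous.sInf_image_of_isCompact (hφ : LowerSemicontinuous φ)
    (hC : IsCompact C) (hne : C.Nonempty) :
    LowerSemicontinuous fun x => sInf ((fun y => φ (x, y)) '' C) := by
  rw [lowerSemicontinuous_iff_isClosed_preimage]
  intro c
  have : CompactSpace C := isCompact_iff_compactSpace.mp hC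
  have hcl : IsClosed {p : X × C | φ (p.1, (p.2 : Y)) ≤ c} :=
    (hφ.isClosed_preimage c).preimage
      (continuous_fst.prodMk (continuous_subtype_val.comp continuous_snd))
  convert isClosedMap_fst_of_compactSpace _ hcl using 1
  ext x
  simp [hφ.sInf_image_le_iff hC hne]

/-- A lower semicontinuous function on `X × S`, with `S` a compact set of reals, has a Borel
selection of minimisers: the smallest one. -/
theorem LowerSemicontinuous.exists_measurable_argmin_real [MeasurableSpace X] [BorelSpace X]
    {S : Set ℝ} (hS : IsCompact S) (hne : S.Nonempty) {ψ : X × S → ℝ}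
    (hψ : LowerSemicontinuous ψ) :
    ∃ s : X → S, Measurable s ∧ ∀ x z, ψ (x, s x) ≤ ψ (x, z) := by
  have : CompactSpace S := isCompact_iff_compactSpace.mp hS
  have : Nonempty S := hne.to_subtype
  let M : X → ℝ := fun x => sInf ((fun y => ψ (x, y)) '' univ)
  have hM : LowerSemicontinuous M := hψ.sInf_image_of_isCompact isCompact_univ univ_nonempty
  have hleast : ∀ x, ∃ y : S, ψ (x, y) ≤ M x ∧ ∀ z : S, ψ (x, z) ≤ M x → y ≤ z := by
    intro x
    have hcl : IsClosed {y : S | ψ (x, y) ≤ M x} :=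
      (hψ.comp (Continuous.prodMk_right x)).isClosed_preimage (M x)
    obtain ⟨y₀, -, hy₀, -⟩ := hψ.exists_eq_sInf_image isCompact_univ univ_nonempty x
    obtain ⟨y, hy, hmin⟩ := hcl.isCompact.exists_isLeast ⟨y₀, hy₀.le⟩
    exact ⟨y, hy, fun z hz => hmin hz⟩
  choose s hs hmin using hleast
  refine ⟨s, ?_, fun x z => (hs x).trans ?_⟩
  · suffices Measurable fun x => (s x : ℝ) from this.subtype_mk
    refine measurable_of_Iic fun r => ?_
    let C : Set S := {y | (y : ℝ) ≤ r}
    have hC : IsCompact C := (isClosed_le continuous_subtype_val continuous_const).isCompact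
    have hpre : (fun x => (s x : ℝ)) ⁻¹' Iic r = {x | ∃ y ∈ C, ψ (x, y) ≤ M x} := by
      ext x
      exact ⟨fun h => ⟨s x, h, hs x⟩, fun ⟨y, hy, h⟩ => (Subtype.coe_le_coe.mpr (hmin x y h)).trans hy⟩
    rw [hpre]
    rcases C.eq_empty_or_nonempty with hCe | hCne
    · simp [hCe]
    · simp_rw [← hψ.sInf_image_le_iff hC hCne]
      exact measurableSet_le (hψ.sInf_image_of_isCompact hC hCne).measurable hM.measurable
  · exact (hψ.sInf_image_le_iff isCompact_univ univ_nonempty x _).mpr ⟨z, mem_univ z, le_rfl⟩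

end Selection

/-- Borel selection of minimisers of a jointly lower semicontinuous function over a compact
subset of a metric space. -/
theorem LowerSemicontinuous.exists_measurable_argmin {X Y : Type*} [TopologicalSpace X]
    [MeasurableSpace X] [BorelSpace X] [MetricSpace Y] [MeasurableSpace Y] [BorelSpace Y]
    {φ : X × Y → ℝ} {C : Set Y} (hφ : LowerSemicontinuous φ) (hC : IsCompact C)
    (hne : C.Nonempty) :
    ∃ ν : X → Y, Measurable ν ∧ (∀ x, ν x ∈ C) ∧
      ∀ x, φ (x, ν x) = sInf ((fun y => φ (x, y)) '' C) := by
  have : CompactSpace C := isCompact_iff_compactSpace.mp hC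
  have : Nonempty C := hne.to_subtype
  obtain ⟨g, hg, hsurj⟩ := exists_nat_bool_continuous_surjective_of_compact C
  let h : cantorSet → Y := fun a => g (cantorSetHomeomorphNatToBool a)
  have hh : Continuous h :=
    continuous_subtype_val.comp (hg.comp cantorSetHomeomorphNatToBool.continuous)
  have hψ : LowerSemicontinuous fun p : X × cantorSet => φ (p.1, h p.2) :=
    hφ.comp (continuous_fst.prodMk (hh.comp continuous_snd))
  obtain ⟨s, hs, hmin⟩ :=
    hψ.exists_measurable_argmin_real isCompact_cantorSet ⟨0, zero_mem_cantorSet⟩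
  refine ⟨fun x => h (s x), hh.measurable.comp hs, fun x => Subtype.coe_prop _, fun x => ?_⟩
  refine (IsLeast.csInf_eq (s := (fun y => φ (x, y)) '' C)
    ⟨⟨h (s x), Subtype.coe_prop _, rfl⟩, ?_⟩).symm
  rintro _ ⟨y, hy, rfl⟩
  obtain ⟨b, hb⟩ := hsurj ⟨y, hy⟩
  have := hmin x (cantorSetHomeomorphNatToBool.symm b)
  simpa [h, hb] using this

section ValueFunction

variable {n m : ℕ} {f : (Fin n → ℝ) → (Fin m → ℝ) → (Fin n → ℝ)} {U : Set (Fin m → ℝ)}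
  {T K D : Set (Fin n → ℝ)}

theorem lowerSemicontinuous_one_sub_indicator {X : Type*} [TopologicalSpace X] {S : Set X}
    (hS : IsClosed S) : LowerSemicontinuous fun x => 1 - S.indicator (fun _ => (1 : ℝ)) x := by
  convert hS.isOpen_compl.lowerSemicontinuous_indicator (zero_le_one' ℝ) using 2 with x
  by_cases hx : x ∈ S <;> simp [hx]

theorem one_sub_indicator_mem_Icc {X : Type*} (S : Set X) (x : X) :
    1 - S.indicator (fun _ => (1 : ℝ)) x ∈ Icc (0 : ℝ) 1 := by
  by_cases hx : x ∈ S <;> simp [hx]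

theorem Jstep_mem_Icc (hU : U.Nonempty) (hD : D.Nonempty) (j : ℕ) (x : Fin n → ℝ) :
    Jstep f U D K T j x ∈ Icc (0 : ℝ) (j + 1) := by
  induction j generalizing x with
  | zero => simpa [Jstep] using one_sub_indicator_mem_Icc T x
  | succ j ih =>
    have hstage : ∀ u w, Jstep f U D K T j (f x u + w) +
        (1 - K.indicator (fun _ => (1 : ℝ)) x) ∈ Icc (0 : ℝ) (j + 1 + 1) := fun u w =>
      ⟨add_nonneg (ih _).1 (one_sub_indicator_mem_Icc K x).1,
        add_le_add (ih _).2 (one_sub_indicator_mem_Icc K x).2⟩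
    have hsup : ∀ u, sSup ((fun w => Jstep f U D K T j (f x u + w) +
        (1 - K.indicator (fun _ => (1 : ℝ)) x)) '' D) ∈ Icc (0 : ℝ) (j + 1 + 1) := fun u =>
      ⟨Real.sSup_nonneg (by rintro _ ⟨w, -, rfl⟩; exact (hstage u w).1),
        csSup_le (hD.image _) (by rintro _ ⟨w, -, rfl⟩; exact (hstage u w).2)⟩
    obtain ⟨u, hu⟩ := hU
    rw [Jstep]
    push_cast
    refine ⟨Real.sInf_nonneg (by rintro _ ⟨u, -, rfl⟩; exact (hsup u).1), ?_⟩
    refine (csInf_le ⟨0, ?_⟩ (mem_image_of_mem _ hu)).trans (hsup u).2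
    rintro _ ⟨u, -, rfl⟩
    exact (hsup u).1

/-- The worst-case cost of one step followed by a lower semicontinuous value function is jointly
lower semicontinuous in the state and the input. -/
theorem lowerSemicontinuous_sSup_Jstep (hK : IsClosed K) (hU : U.Nonempty) (hD : D.Nonempty)
    (hf : Continuous fun p : (Fin n → ℝ) × (Fin m → ℝ) => f p.1 p.2) {j : ℕ}
    (hJ : LowerSemicontinuous (Jstep f U D K T j)) :
    LowerSemicontinuous fun p : (Fin n → ℝ) × (Fin m → ℝ) =>
      sSup ((fun w => Jstep f U D K T j (f p.1 p.2 + w)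
        + (1 - K.indicator (fun _ => (1 : ℝ)) p.1)) '' D) := by
  simp_rw [sSup_image']
  refine lowerSemicontinuous_ciSup (fun p => ⟨j + 1 + 1, ?_⟩) fun w => ?_
  · rintro _ ⟨w, rfl⟩
    exact add_le_add (Jstep_mem_Icc hU hD j _).2 (one_sub_indicator_mem_Icc K p.1).2
  · exact (hJ.comp (hf.add continuous_const)).add
      ((lowerSemicontinuous_one_sub_indicator hK).comp continuous_fst)

theorem lowerSemicontinuous_Jstep (hK : IsClosed K) (hT : IsClosed T) (hU : U.Nonempty)
    (hUcpt : IsCompact U) (hD : D.Nonempty)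
    (hf : Continuous fun p : (Fin n → ℝ) × (Fin m → ℝ) => f p.1 p.2) (j : ℕ) :
    LowerSemicontinuous (Jstep f U D K T j) := by
  induction j with
  | zero => exact lowerSemicontinuous_one_sub_indicator hT
  | succ j ih =>
    exact (lowerSemicontinuous_sSup_Jstep hK hU hD hf ih).sInf_image_of_isCompact hUcpt hU

end ValueFunction


/-- if `𝒦, 𝒯` are closed, `𝒰` is nonempty and compact, `𝒟` is nonempty, and
`f` is continuous, then for every `k ∈ {0,…,t-1}` there is a Borel-measurable state-feedback
law `ν_k : ℝⁿ → 𝒰` attaining the infimum in the minmax recursion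
`J_k(x) = inf_{u ∈ 𝒰} sup_{w ∈ 𝒟} [ J_{k+1}(f(x,u) + w) + g_k(x) ]`,
where `J_k = Jstep (t - k)` and `J_{k+1} = Jstep (t - k - 1)`. -/
theorem minmax_exists_borel_optimal_feedback {n m : ℕ}
    (f : (Fin n → ℝ) → (Fin m → ℝ) → (Fin n → ℝ)) (U : Set (Fin m → ℝ))
    (T K D : Set (Fin n → ℝ))
    (hK : IsClosed K) (hT : IsClosed T)
    (hU : U.Nonempty) (hUcpt : IsCompact U) (hD : D.Nonempty)
    (hf : Continuous fun p : (Fin n → ℝ) × (Fin m → ℝ) => f p.1 p.2)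
    (t : ℕ) :
    ∀ k : ℕ, k < t → ∃ ν : (Fin n → ℝ) → (Fin m → ℝ),
      Measurable ν ∧ (∀ x, ν x ∈ U) ∧
      ∀ x : Fin n → ℝ,
        sSup ((fun w => Jstep f U D K T (t - k - 1) (f x (ν x) + w)
            + (1 - K.indicator (fun _ => (1 : ℝ)) x)) '' D)
          = Jstep f U D K T (t - k) x := by
  intro k hk
  obtain ⟨j, hj⟩ : ∃ j, t - k = j + 1 := ⟨t - k - 1, by omega⟩
  rw [hj, Nat.add_sub_cancel]
  exact (lowerSemicontinuous_sSup_Jstep hK hU hD hf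
    (lowerSemicontinuous_Jstep hK hT hU hUcpt hD hf j)).exists_measurable_argmin hUcpt hU
end

section
/- Suppose 𝒦 ⊆ ℝⁿ and 𝒯 ⊆ ℝⁿ are closed, 𝒰 ⊆ ℝ^m is nonempty and compact, 𝒟 ⊆ ℝⁿ is nonempty, and f : ℝⁿ × ℝ^m → ℝⁿ is continuous, and fix an integer t ≥ 1. Then there exist Borel-measurable state-feedback laws ν_0, …, ν_{t−1} : ℝⁿ → 𝒰 (a Markov policy) such that for every x₀ ∈ RA_t(𝒯, 𝒦, 𝒟) and every disturbance sequence w_0, …, w_{t−1} ∈ 𝒟, the closed-loop trajectory x_{k+1} = f(x_k, ν_k(x_k)) + w_k satisfies x_k ∈ 𝒦 for all k ∈ {0, …, t−1} and x_t ∈ 𝒯. -/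
open Set

/-- Minimizing a continuous function over the values of a measurable multifunction with compact
values gives a measurable multifunction. -/
lemma measurableSet_argmin_inter_nonempty {X Y : Type*} [MeasurableSpace X] [TopologicalSpace Y]
    {F : X → Set Y} (hc : ∀ x, IsCompact (F x))
    (hF : ∀ C, IsClosed C → MeasurableSet {x | (F x ∩ C).Nonempty})
    {φ : Y → ℝ} (hφ : Continuous φ) {C : Set Y} (hC : IsClosed C) :
    MeasurableSet {x | ({u ∈ F x | ∀ v ∈ F x, φ u ≤ φ v} ∩ C).Nonempty} := by
  have key : {x | ({u ∈ F x | ∀ v ∈ F x, φ u ≤ φ v} ∩ C).Nonempty} =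
      {x | (F x ∩ C).Nonempty} ∩ ⋂ q : ℚ, ({x | (F x ∩ {u | φ u ≤ q}).Nonempty}ᶜ ∪
        {x | (F x ∩ (C ∩ {u | φ u ≤ q})).Nonempty}) := by
    ext x
    simp only [mem_inter_iff, mem_iInter, mem_union, mem_compl_iff, mem_ofPred_eq]
    constructor
    · rintro ⟨u, ⟨huF, hmin⟩, huC⟩
      refine ⟨⟨u, huF, huC⟩, fun q => ?_⟩
      rw [← imp_iff_not_or]
      rintro ⟨v, hvF, hvq⟩
      exact ⟨u, huF, huC, (hmin v hvF).trans hvq⟩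
    · rintro ⟨hne, hq⟩
      obtain ⟨u, ⟨huF, huC⟩, hmin⟩ :=
        ((hc x).inter_right hC).exists_isMinOn hne hφ.continuousOn
      refine ⟨u, ⟨huF, fun v hv => ?_⟩, huC⟩
      by_contra! hlt
      obtain ⟨q, hvq, hqu⟩ := exists_rat_btwn hlt
      rcases hq q with h | ⟨w, hwF, hwC, hwq⟩
      · exact h ⟨v, hv, hvq.le⟩
      · exact absurd (hqu.trans_le (hmin ⟨hwF, hwC⟩)) (not_lt.mpr hwq)
  have hle (q : ℚ) : IsClosed {u | φ u ≤ q} := isClosed_le hφ continuous_const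
  rw [key]
  exact (hF C hC).inter (MeasurableSet.iInter fun q =>
    (hF _ (hle q)).compl.union (hF _ (hC.inter (hle q))))

lemma exists_measurable_subselection_eqOn {X ι : Type*} [MeasurableSpace X]
    {F : X → Set (ι → ℝ)} (hc : ∀ x, IsCompact (F x)) (hne : ∀ x, (F x).Nonempty)
    (hF : ∀ C, IsClosed C → MeasurableSet {x | (F x ∩ C).Nonempty}) (S : Finset ι) :
    ∃ G : X → Set (ι → ℝ), (∀ x, G x ⊆ F x) ∧ (∀ x, IsCompact (G x)) ∧ (∀ x, (G x).Nonempty) ∧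
      (∀ C, IsClosed C → MeasurableSet {x | (G x ∩ C).Nonempty}) ∧
      ∀ x, ∀ u ∈ G x, ∀ v ∈ G x, ∀ i ∈ S, u i = v i := by
  classical
  induction S using Finset.induction_on with
  | empty => exact ⟨F, fun _ => Subset.rfl, hc, hne, hF, by simp⟩
  | insert i S _ ih =>
    obtain ⟨G, hGF, hGc, hGne, hG, hGS⟩ := ih
    have hi : Continuous fun u : ι → ℝ => u i := continuous_apply i
    refine ⟨fun x => {u ∈ G x | ∀ v ∈ G x, u i ≤ v i}, fun x u hu => hGF x hu.1, fun x => ?_,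
      fun x => ?_, fun C hC => measurableSet_argmin_inter_nonempty hGc hG hi hC, ?_⟩
    · have hcl : IsClosed {u : ι → ℝ | ∀ v ∈ G x, u i ≤ v i} := by
        simp only [ofPred_forall]
        exact isClosed_iInter fun v => isClosed_iInter fun _ => isClosed_le hi continuous_const
      exact (hGc x).inter_right hcl
    · obtain ⟨u, hu, hmin⟩ := (hGc x).exists_isMinOn (hGne x) hi.continuousOn
      exact ⟨u, hu, fun v hv => hmin hv⟩
    · intro x u hu v hv j hj
      rcases Finset.mem_insert.mp hj with rfl | hj
      · exact le_antisymm (hu.2 v hv.1) (hv.2 u hu.1)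
      · exact hGS x u hu.1 v hv.1 j hj

/-- A measurable multifunction with nonempty compact values in `ℝ^ι` has a measurable selection. -/
lemma exists_measurable_selection {X ι : Type*} [MeasurableSpace X] [Fintype ι]
    {F : X → Set (ι → ℝ)} (hc : ∀ x, IsCompact (F x)) (hne : ∀ x, (F x).Nonempty)
    (hF : ∀ C, IsClosed C → MeasurableSet {x | (F x ∩ C).Nonempty}) :
    ∃ s : X → ι → ℝ, Measurable s ∧ ∀ x, s x ∈ F x := by
  obtain ⟨G, hGF, -, hGne, hG, hGS⟩ :=
    exists_measurable_subselection_eqOn hc hne hF Finset.univ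
  choose s hs using hGne
  refine ⟨s, measurable_of_isClosed fun C hC => ?_, fun x => hGF x (hs x)⟩
  convert hG C hC using 1
  ext x
  refine ⟨fun h => ⟨s x, hs x, h⟩, ?_⟩
  rintro ⟨u, hu, huC⟩
  have : s x = u := funext fun i => hGS x _ (hs x) u hu i (Finset.mem_univ i)
  rwa [mem_preimage, this]

lemma isClosed_setOf_exists_mem_of_isCompact {X Y : Type*} [TopologicalSpace X]
    [TopologicalSpace Y] {U : Set Y} (hU : IsCompact U) {G : Set (X × Y)} (hG : IsClosed G) :
    IsClosed {x | ∃ u ∈ U, (x, u) ∈ G} := by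
  have := isCompact_iff_compactSpace.mp hU
  have hcl : IsClosed {p : X × U | (p.1, (p.2 : Y)) ∈ G} := hG.preimage (by fun_prop)
  convert isClosedMap_fst_of_compactSpace _ hcl using 1
  ext x
  simp

lemma exists_measurable_selection_of_isClosed {X ι : Type*} [TopologicalSpace X]
    [MeasurableSpace X] [OpensMeasurableSpace X] [Fintype ι] {U : Set (ι → ℝ)}
    (hU : IsCompact U) (hne : U.Nonempty) {G : Set (X × (ι → ℝ))} (hG : IsClosed G) :
    ∃ s : X → ι → ℝ, Measurable s ∧ (∀ x, s x ∈ U) ∧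
      ∀ x, (∃ u ∈ U, (x, u) ∈ G) → (x, s x) ∈ G := by
  set A : Set X := {x | ∃ u ∈ U, (x, u) ∈ G}
  have hAm : MeasurableSet A := (isClosed_setOf_exists_mem_of_isCompact hU hG).measurableSet
  suffices h : ∃ s : X → ι → ℝ, Measurable s ∧ ∀ x, s x ∈ {u ∈ U | x ∈ A → (x, u) ∈ G} by
    obtain ⟨s, hs, hsF⟩ := h
    exact ⟨s, hs, fun x => (hsF x).1, fun x hx => (hsF x).2 hx⟩
  refine exists_measurable_selection (fun x => ?_) (fun x => ?_) (fun C hC => ?_)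
  · by_cases hx : x ∈ A
    · simp only [hx, true_imp_iff]
      exact hU.inter_right (hG.preimage (Continuous.prodMk_right x))
    · simpa [hx] using hU
  · by_cases hx : x ∈ A
    · obtain ⟨u, hu, huG⟩ := hx
      exact ⟨u, hu, fun _ => huG⟩
    · obtain ⟨u, hu⟩ := hne
      exact ⟨u, hu, fun h => absurd h hx⟩
  · have hGC : MeasurableSet {x | ∃ u ∈ U, (x, u) ∈ G ∩ Prod.snd ⁻¹' C} :=
      (isClosed_setOf_exists_mem_of_isCompact hU
        (hG.inter (hC.preimage continuous_snd))).measurableSet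
    convert hGC.union (hAm.compl.inter (MeasurableSet.const (U ∩ C).Nonempty)) using 1
    ext x
    constructor
    · rintro ⟨u, ⟨hu, huG⟩, huC⟩
      by_cases hx : x ∈ A
      · exact Or.inl ⟨u, hu, huG hx, huC⟩
      · exact Or.inr ⟨hx, u, hu, huC⟩
    · rintro (⟨u, hu, huG, huC⟩ | ⟨hx, u, hu, huC⟩)
      · exact ⟨u, ⟨hu, fun _ => huG⟩, huC⟩
      · exact ⟨u, ⟨hu, fun h => absurd h hx⟩, huC⟩

section ReachAvoid

variable {n m : ℕ} (f : (Fin n → ℝ) → (Fin m → ℝ) → (Fin n → ℝ)) (U : Set (Fin m → ℝ))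
  (T K D : Set (Fin n → ℝ))

/-- State-input pairs that are safe now and lie in `V` after one step, for every disturbance. -/
def robustPre (V : Set (Fin n → ℝ)) : Set ((Fin n → ℝ) × (Fin m → ℝ)) :=
  {p | p.1 ∈ K ∧ ∀ d ∈ D, f p.1 p.2 + d ∈ V}

/-- The dynamic programming recursion for the reach-avoid sets, indexed by the steps to go. -/
def reachAvoidRec : ℕ → Set (Fin n → ℝ)
  | 0 => T
  | j + 1 => {x | ∃ u ∈ U, (x, u) ∈ robustPre f K D (reachAvoidRec j)}

variable {f U T K D}

lemma isClosed_robustPre (hK : IsClosed K)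
    (hf : Continuous fun p : (Fin n → ℝ) × (Fin m → ℝ) => f p.1 p.2)
    {V : Set (Fin n → ℝ)} (hV : IsClosed V) : IsClosed (robustPre f K D V) := by
  have h : IsClosed {p : (Fin n → ℝ) × (Fin m → ℝ) | ∀ d ∈ D, f p.1 p.2 + d ∈ V} := by
    simp only [ofPred_forall]
    exact isClosed_iInter fun d => isClosed_iInter fun _ =>
      hV.preimage (hf.add continuous_const)
  exact (hK.preimage continuous_fst).inter h

lemma isClosed_reachAvoidRec (hK : IsClosed K) (hT : IsClosed T) (hU : IsCompact U)
    (hf : Continuous fun p : (Fin n → ℝ) × (Fin m → ℝ) => f p.1 p.2) (j : ℕ) :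
    IsClosed (reachAvoidRec f U T K D j) := by
  induction j with
  | zero => exact hT
  | succ j ih => exact isClosed_setOf_exists_mem_of_isCompact hU (isClosed_robustPre hK hf ih)

lemma traj_succ_shift (ν : ℕ → (Fin n → ℝ) → (Fin m → ℝ)) (w : ℕ → (Fin n → ℝ))
    (x0 : Fin n → ℝ) (k : ℕ) :
    traj f ν w x0 (k + 1) =
      traj f (fun i => ν (i + 1)) (fun i => w (i + 1)) (f x0 (ν 0 x0) + w 0) k := by
  induction k with
  | zero => rfl
  | succ k ih => rw [traj, ih, traj]

lemma RA_subset_reachAvoidRec (hD : D.Nonempty) (t : ℕ) :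
    RA f U T K D t ⊆ reachAvoidRec f U T K D t := by
  induction t with
  | zero =>
    rintro x ⟨ν, -, h⟩
    exact (h 0 (by simp)).2
  | succ t ih =>
    rintro x ⟨ν, hν, h⟩
    obtain ⟨d₀, hd₀⟩ := hD
    refine ⟨ν 0 x, hν 0 t.succ_pos x, (h (fun _ => d₀) fun _ _ => hd₀).1 0 t.succ_pos,
      fun d hd => ih ⟨fun i => ν (i + 1), fun k hk => hν (k + 1) (by omega), fun w hw => ?_⟩⟩
    let w' : ℕ → (Fin n → ℝ) := fun i => Nat.casesOn i d w
    have hw' : ∀ k, k < t + 1 → w' k ∈ D := by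
      rintro (_ | k) hk
      · exact hd
      · exact hw k (by omega)
    obtain ⟨h1, h2⟩ := h w' hw'
    refine ⟨fun k hk => ?_, ?_⟩
    · have := h1 (k + 1) (by omega)
      rwa [traj_succ_shift] at this
    · rwa [traj_succ_shift] at h2

end ReachAvoid

/-- under closedness of `𝒦, 𝒯`, compactness of `𝒰`, and continuity of `f`,
there exists a Markov policy (a sequence of Borel-measurable feedback laws into `𝒰`)
achieving the reach-avoid objective from every state of `RA_t(𝒯, 𝒦, 𝒟)` for every
disturbance sequence in `𝒟`. -/
theorem exists_markov_policy_for_robust_reach_avoid {n m : ℕ}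
    (f : (Fin n → ℝ) → (Fin m → ℝ) → (Fin n → ℝ)) (U : Set (Fin m → ℝ))
    (T K D : Set (Fin n → ℝ))
    (hK : IsClosed K) (hT : IsClosed T)
    (hU : U.Nonempty) (hUcpt : IsCompact U) (hD : D.Nonempty)
    (hf : Continuous fun p : (Fin n → ℝ) × (Fin m → ℝ) => f p.1 p.2)
    (t : ℕ) (ht : 1 ≤ t) :
    ∃ ν : ℕ → (Fin n → ℝ) → (Fin m → ℝ),
      (∀ k, k < t → Measurable (ν k) ∧ ∀ x, ν k x ∈ U) ∧
      ∀ x0 ∈ RA f U T K D t, ∀ w : ℕ → (Fin n → ℝ), (∀ k, k < t → w k ∈ D) →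
        (∀ k, k < t → traj f ν w x0 k ∈ K) ∧ traj f ν w x0 t ∈ T := by
  have hsel (j : ℕ) := exists_measurable_selection_of_isClosed hUcpt hU
    (isClosed_robustPre (D := D) hK hf (isClosed_reachAvoidRec (D := D) hK hT hUcpt hf j))
  choose s hs hsU hsG using hsel
  refine ⟨fun k => s (t - 1 - k), fun k _ => ⟨hs _, hsU _⟩, fun x0 hx0 w hw => ?_⟩
  have step (k : ℕ) (hk : k < t) (x : Fin n → ℝ) (hx : x ∈ reachAvoidRec f U T K D (t - k)) :
      (x, s (t - 1 - k) x) ∈ robustPre f K D (reachAvoidRec f U T K D (t - (k + 1))) := by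
    rw [show t - k = (t - 1 - k) + 1 by omega] at hx
    rw [show t - (k + 1) = t - 1 - k by omega]
    exact hsG _ x hx
  have inv (k : ℕ) (hk : k ≤ t) :
      traj f (fun k => s (t - 1 - k)) w x0 k ∈ reachAvoidRec f U T K D (t - k) := by
    induction k with
    | zero => exact RA_subset_reachAvoidRec hD t hx0
    | succ k ih => exact (step k hk _ (ih (by omega))).2 (w k) (hw k hk)
  refine ⟨fun k hk => (step k hk _ (inv k hk.le)).1, ?_⟩
  have := inv t le_rfl
  rwa [Nat.sub_self] at this
end

section
/- Suppose 𝒦 ⊆ ℝⁿ and 𝒯 ⊆ ℝⁿ are closed, 𝒰 ⊆ ℝ^m is nonempty and compact, and f : ℝⁿ × ℝ^m → ℝⁿ is continuous. Let P be a Borel probability measure on ℝⁿ, let β ∈ [0,1], let t ≥ 1 be an integer, and let 𝒟 ⊆ ℝⁿ be a nonempty Borel set with P(𝒟) = β^{1/t}. Then there exist Borel-measurable state-feedback laws ν_0, …, ν_{t−1} : ℝⁿ → 𝒰 such that for every x₀ ∈ RA_t(𝒯, 𝒦, 𝒟), the t-fold product measure P^{⊗t} of the set of disturbance sequences (w_0,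 …, w_{t−1}) ∈ (ℝⁿ)^t for which the closed-loop trajectory x_{k+1} = f(x_k, ν_k(x_k)) + w_k from x₀ satisfies x_k ∈ 𝒦 for all k ∈ {0, …, t−1} and x_t ∈ 𝒯 is at least β. -/
open MeasureTheory

open Set in
/-- A closed relation over a nonempty compact metric space admits a Borel-measurable selection. -/
theorem exists_measurable_selection_of_isClosed_s9 {X Y : Type*} [TopologicalSpace X]
    [MeasurableSpace X] [OpensMeasurableSpace X] [MetricSpace Y] [CompactSpace Y] [Nonempty Y]
    [MeasurableSpace Y] [BorelSpace Y] {F : Set (X × Y)} (hF : IsClosed F) :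
    ∃ g : X → Y, Measurable g ∧ ∀ x y, (x, y) ∈ F → (x, g x) ∈ F := by
  classical
  obtain ⟨φ₀, hφ₀, hφ₀s⟩ := exists_nat_bool_continuous_surjective_of_compact Y
  obtain ⟨φ, hφ, hφs⟩ : ∃ φ : cantorSet → Y, Continuous φ ∧ Function.Surjective φ :=
    ⟨φ₀ ∘ cantorSetHomeomorphNatToBool, hφ₀.comp cantorSetHomeomorphNatToBool.continuous,
      hφ₀s.comp cantorSetHomeomorphNatToBool.surjective⟩
  have : CompactSpace cantorSet := isCompact_iff_compactSpace.mp isCompact_cantorSet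
  let G : Set (X × cantorSet) := {p | (p.1, φ p.2) ∈ F}
  have hG : IsClosed G := hF.preimage (by fun_prop)
  have hmin : ∀ x, (∃ s, (x, s) ∈ G) → ∃ s, IsLeast {s | (x, s) ∈ G} s := fun x hx =>
    (hG.preimage (by fun_prop : Continuous fun s => (x, s))).isCompact.exists_isLeast hx
  let s₀ : cantorSet := (hφs (Classical.arbitrary Y)).choose
  have : Nonempty cantorSet := ⟨s₀⟩
  choose! h hh using hmin
  let A : Set X := Prod.fst '' G
  have hA : IsClosed A := isClosedMap_fst_of_compactSpace _ hG
  have hmeas : Measurable (A.piecewise h fun _ => s₀) := by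
    refine Measurable.subtype_mk (f := fun x => (A.piecewise h (fun _ => s₀) x : ℝ))
      (measurable_of_Iic fun c => ?_) (h := fun x => Subtype.prop _)
    have hB : IsClosed (Prod.fst '' (G ∩ {p | (p.2 : ℝ) ≤ c})) :=
      isClosedMap_fst_of_compactSpace _
        (hG.inter (isClosed_le (by fun_prop) continuous_const))
    have hset : A ∩ h ⁻¹' {s | (s : ℝ) ≤ c} = Prod.fst '' (G ∩ {p | (p.2 : ℝ) ≤ c}) := by
      ext x
      constructor
      · rintro ⟨⟨⟨x', s⟩, hs, rfl⟩, hx⟩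
        exact ⟨(x', h x'), ⟨(hh x' ⟨s, hs⟩).1, hx⟩, rfl⟩
      · rintro ⟨⟨x', s⟩, ⟨hs, hsc⟩, rfl⟩
        have hle : (h x' : ℝ) ≤ s := (hh x' ⟨s, hs⟩).2 hs
        exact ⟨⟨_, hs, rfl⟩, hle.trans hsc⟩
    change MeasurableSet (A.piecewise h (fun _ => s₀) ⁻¹' {s | (s : ℝ) ≤ c})
    rw [piecewise_preimage, Set.ite, inter_comm, hset]
    exact hB.measurableSet.union ((MeasurableSet.const ((s₀ : ℝ) ≤ c)).diff hA.measurableSet)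
  refine ⟨φ ∘ A.piecewise h fun _ => s₀, hφ.measurable.comp hmeas, fun x y hxy => ?_⟩
  obtain ⟨s, rfl⟩ := hφs y
  have hx : x ∈ A := ⟨(x, s), hxy, rfl⟩
  rw [Function.comp_apply, piecewise_eq_of_mem _ _ _ hx]
  exact (hh x ⟨s, hxy⟩).1

section

variable {n m : ℕ} {f : (Fin n → ℝ) → (Fin m → ℝ) → (Fin n → ℝ)} {U : Set (Fin m → ℝ)}
  {T K D : Set (Fin n → ℝ)}

/-- The backward dynamic-programming recursion for the robust reach-avoid set. -/
def backwardSet (f : (Fin n → ℝ) → (Fin m → ℝ) → (Fin n → ℝ)) (U : Set (Fin m → ℝ))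
    (T K D : Set (Fin n → ℝ)) : ℕ → Set (Fin n → ℝ)
  | 0 => T
  | j + 1 => K ∩ {x | ∃ u ∈ U, ∀ w ∈ D, f x u + w ∈ backwardSet f U T K D j}

theorem isClosed_setOf_forall_add_mem
    (hf : Continuous fun p : (Fin n → ℝ) × (Fin m → ℝ) => f p.1 p.2)
    {V : Set (Fin n → ℝ)} (hV : IsClosed V) :
    IsClosed {p : (Fin n → ℝ) × U | ∀ w ∈ D, f p.1 p.2 + w ∈ V} := by
  have hf' : Continuous fun p : (Fin n → ℝ) × U => f p.1 p.2 :=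
    hf.comp (by fun_prop : Continuous fun p : (Fin n → ℝ) × U => (p.1, (p.2 : Fin m → ℝ)))
  simp only [Set.ofPred_forall]
  exact isClosed_biInter fun w _ => hV.preimage (hf'.add continuous_const)

theorem isClosed_backwardSet (hK : IsClosed K) (hT : IsClosed T) (hU : IsCompact U)
    (hf : Continuous fun p : (Fin n → ℝ) × (Fin m → ℝ) => f p.1 p.2) (j : ℕ) :
    IsClosed (backwardSet f U T K D j) := by
  induction j with
  | zero => exact hT
  | succ j ih =>
    have : CompactSpace U := isCompact_iff_compactSpace.mp hU
    refine hK.inter ?_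
    convert isClosedMap_fst_of_compactSpace _
      (isClosed_setOf_forall_add_mem (U := U) (D := D) hf ih) using 1
    ext x
    simp

theorem traj_succ_eq (ν : ℕ → (Fin n → ℝ) → (Fin m → ℝ)) (w : ℕ → (Fin n → ℝ))
    (x0 : Fin n → ℝ) (k : ℕ) :
    traj f ν w x0 (k + 1) =
      traj f (fun j => ν (j + 1)) (fun j => w (j + 1)) (f x0 (ν 0 x0) + w 0) k := by
  induction k with
  | zero => rfl
  | succ k ih => rw [traj, ih]; rfl

theorem RA_subset_backwardSet (hD : D.Nonempty) (t : ℕ) :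
    RA f U T K D t ⊆ backwardSet f U T K D t := by
  obtain ⟨d, hd⟩ := hD
  induction t with
  | zero =>
    rintro x0 ⟨ν, -, h⟩
    exact (h (fun _ => d) fun _ _ => hd).2
  | succ t ih =>
    rintro x0 ⟨ν, hν, h⟩
    refine ⟨(h (fun _ => d) fun _ _ => hd).1 0 t.succ_pos, ν 0 x0, hν 0 t.succ_pos x0,
      fun w₀ hw₀ => ih ⟨fun j => ν (j + 1), fun k hk => hν (k + 1) (by omega), fun w hw => ?_⟩⟩
    have h' := h (fun j => Nat.casesOn j w₀ w) fun k hk => by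
      cases k with
      | zero => exact hw₀
      | succ k => exact hw k (by omega)
    refine ⟨fun k hk => ?_, ?_⟩
    · have := h'.1 (k + 1) (by omega)
      rwa [traj_succ_eq] at this
    · have := h'.2
      rwa [traj_succ_eq] at this

/-- A single measurable Markov policy is robustly optimal from all of the reach-avoid set. -/
theorem exists_measurable_robust_policy (hK : IsClosed K) (hT : IsClosed T) (hU : U.Nonempty)
    (hUcpt : IsCompact U)
    (hf : Continuous fun p : (Fin n → ℝ) × (Fin m → ℝ) => f p.1 p.2) (hD : D.Nonempty) (t : ℕ) :
    ∃ ν : ℕ → (Fin n → ℝ) → (Fin m → ℝ), (∀ k, Measurable (ν k) ∧ ∀ x, ν k x ∈ U) ∧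
      ∀ x0 ∈ RA f U T K D t, ∀ w : ℕ → (Fin n → ℝ), (∀ k, k < t → w k ∈ D) →
        (∀ k, k < t → traj f ν w x0 k ∈ K) ∧ traj f ν w x0 t ∈ T := by
  have : CompactSpace U := isCompact_iff_compactSpace.mp hUcpt
  have : Nonempty U := hU.to_subtype
  choose g hgm hg using fun j => exists_measurable_selection_of_isClosed_s9
    (isClosed_setOf_forall_add_mem (U := U) (D := D) hf
      (isClosed_backwardSet (D := D) hK hT hUcpt hf j))
  refine ⟨fun k x => g (t - (k + 1)) x,
    fun k => ⟨measurable_subtype_coe.comp (hgm _), fun x => (g _ x).2⟩, fun x0 hx0 w hw => ?_⟩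
  have key : ∀ k ≤ t, traj f (fun k x => g (t - (k + 1)) x) w x0 k ∈
      backwardSet f U T K D (t - k) := by
    intro k
    induction k with
    | zero => exact fun _ => RA_subset_backwardSet hD t hx0
    | succ k ih =>
      intro hk
      have h := ih (by omega)
      rw [show t - k = t - (k + 1) + 1 by omega] at h
      obtain ⟨-, u, hu, hmem⟩ := h
      exact hg (t - (k + 1)) _ ⟨u, hu⟩ hmem (w k) (hw k hk)
  refine ⟨fun k hk => ?_, by simpa [backwardSet] using key t le_rfl⟩
  have h := key k hk.le
  rw [show t - k = t - (k + 1) + 1 by omega] at h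
  exact h.1

end

/-- if `P(𝒟) = β^{1/t}`, then there is a Markov policy (Borel-measurable
feedback laws into `𝒰`) such that from every state of `RA_t(𝒯, 𝒦, 𝒟)` the probability
(under the i.i.d. disturbance law `P^{⊗t}`) of achieving the reach-avoid objective is at
least `β`. -/
theorem markov_policy_prob_reach_avoid_ge {n m : ℕ}
    (f : (Fin n → ℝ) → (Fin m → ℝ) → (Fin n → ℝ)) (U : Set (Fin m → ℝ))
    (T K D : Set (Fin n → ℝ))
    (hK : IsClosed K) (hT : IsClosed T)
    (hU : U.Nonempty) (hUcpt : IsCompact U)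
    (hf : Continuous fun p : (Fin n → ℝ) × (Fin m → ℝ) => f p.1 p.2)
    (P : Measure (Fin n → ℝ)) [IsProbabilityMeasure P]
    (β : ℝ) (hβ0 : 0 ≤ β) (hβ1 : β ≤ 1)
    (t : ℕ) (ht : 1 ≤ t)
    (hD : D.Nonempty) (hDm : MeasurableSet D)
    (hPD : P D = ENNReal.ofReal (β ^ (1 / (t : ℝ)))) :
    ∃ ν : ℕ → (Fin n → ℝ) → (Fin m → ℝ),
      (∀ k, k < t → Measurable (ν k) ∧ ∀ x, ν k x ∈ U) ∧
      ∀ x0 ∈ RA f U T K D t,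
        ENNReal.ofReal β ≤
          Measure.pi (fun _ : Fin t => P)
            {w : Fin t → (Fin n → ℝ) |
              (∀ k, k < t →
                traj f ν (fun j => if h : j < t then w ⟨j, h⟩ else 0) x0 k ∈ K) ∧
              traj f ν (fun j => if h : j < t then w ⟨j, h⟩ else 0) x0 t ∈ T} := by
  obtain ⟨ν, hν, h⟩ := exists_measurable_robust_policy hK hT hU hUcpt hf hD t
  refine ⟨ν, fun k _ => hν k, fun x0 hx0 => ?_⟩
  calc ENNReal.ofReal β = Measure.pi (fun _ : Fin t => P) (Set.univ.pi fun _ => D) := by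
        rw [Measure.pi_pi, Finset.prod_const, Finset.card_univ, Fintype.card_fin, hPD,
          ← ENNReal.ofReal_pow (by positivity), one_div,
          Real.rpow_inv_natCast_pow hβ0 (by omega)]
    _ ≤ _ := measure_mono fun w hw =>
        h x0 hx0 _ fun k hk => by simpa [hk] using hw ⟨k, hk⟩ (Set.mem_univ _)
end
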